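/- Let v ∈ W^P, let α ∈ Δ be such that s_α v < v in the Bruhat order, and set β = −v⁻¹(α). Then β is a maximal element of Φ⁺(v) with respect to the dominance order, and β is a minimal element of Ψ ∖ Φ⁺(s_α v) with respect to the dominance order. -/

import Mathlib

open scoped RealInnerProductSpace
open Classical

noncomputable section

variable (V : Type) [NormedAddCommGroup V] [InnerProductSpace ℝ V]

/-- The reflection determined by a vector `α` (the identity map if `α = 0`),
as a linear endomorphism:  `x ↦ x - (2⟪x,α⟫/⟪α,α⟫) • α`. -/
def reflMap (α : V) : V →ₗ[ℝ] V where
  toFun x := x - (2 * ⟪x, α⟫ / ⟪α, α⟫) • α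
  map_add' x y := by
    simp only [inner_add_left]
    rw [show 2 * (⟪x, α⟫ + ⟪y, α⟫) / ⟪α, α⟫
        = 2 * ⟪x, α⟫ / ⟪α, α⟫ + 2 * ⟪y, α⟫ / ⟪α, α⟫ by ring, add_smul]
    abel
  map_smul' c x := by
    simp only [real_inner_smul_left, RingHom.id_apply, smul_sub]
    rw [show 2 * (c * ⟪x, α⟫) / ⟪α, α⟫ = c * (2 * ⟪x, α⟫ / ⟪α, α⟫) by ring,
      mul_smul]

lemma reflMap_apply (α x : V) :
    reflMap V α x = x - (2 * ⟪x, α⟫ / ⟪α, α⟫) • α := rfl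

lemma reflMap_involutive (α : V) : ∀ x, reflMap V α (reflMap V α x) = x := by
  intro x
  by_cases h : (⟪α, α⟫ : ℝ) = 0
  · have h0 : α = 0 := inner_self_eq_zero.mp h
    simp [reflMap_apply, h0]
  · rw [reflMap_apply, reflMap_apply, inner_sub_left, real_inner_smul_left,
      div_mul_cancel₀ _ h]
    rw [show ⟪x, α⟫ - 2 * ⟪x, α⟫ = -⟪x, α⟫ by ring]
    rw [show 2 * -⟪x, α⟫ / ⟪α, α⟫ = -(2 * ⟪x, α⟫ / ⟪α, α⟫) by ring, neg_smul]
    abel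

/-- The reflection determined by a vector `α`, as a linear automorphism of `V`. -/
def sref (α : V) : V ≃ₗ[ℝ] V :=
  { reflMap V α with
    invFun := reflMap V α
    left_inv := reflMap_involutive V α
    right_inv := reflMap_involutive V α }

lemma sref_apply (α x : V) :
    sref V α x = x - (2 * ⟪x, α⟫ / ⟪α, α⟫) • α := rfl

variable {V}

/-- The coroot `α^∨ = 2α/⟪α,α⟫` associated with a root `α`, under the identification of the
coweight space with `V` given by the inner product. -/
def coroot (α : V) : V := (2 / ⟪α, α⟫) • α

/-- The dimension of the `(-1)`-eigenspace of a linear automorphism. -/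
def lamEig (σ : V ≃ₗ[ℝ] V) : ℕ :=
  Module.finrank ℝ (Module.End.eigenspace (σ : V →ₗ[ℝ] V) (-1))

/-- The action `s_α ∘ σ` of a simple reflection on an involution: `s_α σ` if `s_α` and `σ`
commute, and `s_α σ s_α` otherwise. -/
def circAct (α : V) (σ : V ≃ₗ[ℝ] V) : V ≃ₗ[ℝ] V :=
  if sref V α * σ = σ * sref V α then sref V α * σ else sref V α * σ * sref V α

/-- A set of pairwise orthogonal vectors. -/
def OrthSet (S : Finset V) : Prop :=
  (↑S : Set V).Pairwise fun a b => ⟪a, b⟫ = 0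

/-- The product `σ_S` of the (commuting) reflections in the elements of an orthogonal set
`S`. -/
def sigmaOf (S : Finset V) : V ≃ₗ[ℝ] V :=
  (S.toList.map (sref V)).prod

variable (V)

/-- A finite crystallographic reduced root system in the Euclidean space `V`,
together with a fixed choice of simple roots. -/
structure RSD where
  /-- The set of roots. -/
  Φ : Finset V
  /-- The set of simple roots. -/
  Δ : Finset V
  nonzero : (0 : V) ∉ Φ
  span_top : Submodule.span ℝ (Φ : Set V) = ⊤
  reduced : ∀ α ∈ Φ, ∀ c : ℝ, c • α ∈ Φ → c = 1 ∨ c = -1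
  crystal : ∀ α ∈ Φ, ∀ β ∈ Φ, ∃ n : ℤ, (n : ℝ) = 2 * ⟪β, α⟫ / ⟪α, α⟫
  reflClosed : ∀ α ∈ Φ, ∀ β ∈ Φ, sref V α β ∈ Φ
  Δ_sub : Δ ⊆ Φ
  Δ_indep : LinearIndependent ℝ (fun x : (Δ : Set V) => (x : V))
  Δ_base : ∀ α ∈ Φ, (∃ c : V → ℕ, α = ∑ γ ∈ Δ, (c γ : ℝ) • γ) ∨
      (∃ c : V → ℕ, -α = ∑ γ ∈ Δ, (c γ : ℝ) • γ)

namespace RSD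

variable {V}
variable (D : RSD V)

/-- The set of positive roots. -/
def Pos : Set V :=
  {α | α ∈ D.Φ ∧ ∃ c : V → ℕ, α = ∑ γ ∈ D.Δ, (c γ : ℝ) • γ}

/-- The set of negative roots. -/
def Neg : Set V := {α | -α ∈ D.Pos}

/-- The Weyl group, as the subgroup of `GL(V)` generated by the simple reflections. -/
def W : Subgroup (V ≃ₗ[ℝ] V) := Subgroup.closure ((fun γ => sref V γ) '' ↑D.Δ)

/-- The length of `w`: the least number of simple reflections needed to write `w` as a
product of simple reflections. -/
def length (w : V ≃ₗ[ℝ] V) : ℕ :=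
  sInf {n | ∃ l : List V, l.length = n ∧ (∀ γ ∈ l, γ ∈ D.Δ) ∧ w = (l.map (sref V)).prod}

/-- The Bruhat order on the Weyl group: `u ≤ v` iff `v` is obtained from `u` by successively
multiplying by reflections, each time increasing the length. -/
def ble (u v : V ≃ₗ[ℝ] V) : Prop :=
  Relation.ReflTransGen
    (fun x y => (∃ β ∈ D.Φ, y = sref V β * x) ∧ D.length x < D.length y) u v

/-- The strict Bruhat order. -/
def blt (u v : V ≃ₗ[ℝ] V) : Prop := D.ble u v ∧ u ≠ v

/-- The dominance order: `y - x` is a nonnegative integer combination of simple roots. -/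
def dom (x y : V) : Prop := ∃ c : V → ℕ, y - x = ∑ γ ∈ D.Δ, (c γ : ℝ) • γ

/-- The dominance order on coweights: `y - x` is a nonnegative integer combination of simple
coroots. -/
def cdom (x y : V) : Prop := ∃ c : V → ℕ, y - x = ∑ γ ∈ D.Δ, (c γ : ℝ) • coroot γ

/-- The length `L(σ) = (ℓ(σ) + λ(σ))/2` of an involution `σ`, where `λ(σ)` is the dimension
of the `(-1)`-eigenspace of `σ`. -/
def Linv (σ : V ≃ₗ[ℝ] V) : ℚ :=
  ((D.length σ : ℚ) + (lamEig σ : ℚ)) / 2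

end RSD

/-- A finite irreducible crystallographic reduced root system, with a fixed choice of simple
roots and a marked simple root `αP` whose coefficient in the highest root `θ` equals `1`
(the cominuscule case). -/
structure MRSD extends RSD V where
  irred : ¬ ∃ A B : Set V, A.Nonempty ∧ B.Nonempty ∧ A ∪ B = ↑Φ ∧
      ∀ α ∈ A, ∀ β ∈ B, ⟪α, β⟫ = 0
  /-- The marked simple root. -/
  αP : V
  αP_mem : αP ∈ Δ
  /-- The highest root. -/
  θ : V
  θ_mem : θ ∈ Φ
  θ_high : ∀ α ∈ Φ, ∃ c : V → ℕ, θ - α = ∑ γ ∈ Δ, (c γ : ℝ) • γ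
  θ_coeff : ∃ c : V → ℕ, (θ = ∑ γ ∈ Δ, (c γ : ℝ) • γ) ∧ c αP = 1

namespace MRSD

variable {V}
variable (M : MRSD V)

/-- The set `Ψ` of positive roots in which the marked simple root `αP` has coefficient `1`. -/
def Psi : Set V :=
  {α | α ∈ M.Φ ∧ ∃ c : V → ℕ, (α = ∑ γ ∈ M.Δ, (c γ : ℝ) • γ) ∧ c M.αP = 1}

/-- The set of positive roots of the subsystem `Φ_P`, i.e. the positive roots in which the
marked simple root `αP` has coefficient `0`. -/
def PosP : Set V :=
  {α | α ∈ M.Φ ∧ ∃ c : V → ℕ, (α = ∑ γ ∈ M.Δ, (c γ : ℝ) • γ) ∧ c M.αP = 0}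

/-- The parabolic subgroup `W_P` generated by the simple reflections in `Δ ∖ {αP}`. -/
def WP : Subgroup (V ≃ₗ[ℝ] V) :=
  Subgroup.closure ((fun γ => sref V γ) '' ↑(M.Δ.erase M.αP))

/-- The inversion set `Φ⁺(v) = {α ∈ Φ⁺ : v(α) ∈ Φ⁻}`. -/
def InvSet (v : V ≃ₗ[ℝ] V) : Set V := {α | α ∈ M.Pos ∧ v α ∈ M.Neg}

/-- `v` belongs to `W^P`: it lies in `W` and has minimal length in its coset `v W_P`. -/
def IsMinRep (v : V ≃ₗ[ℝ] V) : Prop :=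
  v ∈ M.W ∧ ∀ u, u ∈ M.W → v⁻¹ * u ∈ M.WP → M.length v ≤ M.length u

/-- `μ` is the minimal length representative `[w]^P` of the coset `w W_P`. -/
def IsMinRepOf (μ w : V ≃ₗ[ℝ] V) : Prop :=
  (μ ∈ M.W ∧ w⁻¹ * μ ∈ M.WP) ∧
    ∀ u, u ∈ M.W → w⁻¹ * u ∈ M.WP → M.length μ ≤ M.length u

/-- The subset `Φ_S = {α ∈ Φ : σ_S(α) = -α}` determined by an orthogonal set of roots `S`. -/
def PhiSet (S : Finset V) : Set V := {α | α ∈ M.Φ ∧ sigmaOf S α = -α}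

/-- A root is long if its squared length is maximal among the roots. -/
def IsLong (α : V) : Prop := ∀ β ∈ M.Φ, ⟪β, β⟫ ≤ ⟪α, α⟫

/-- Admissible pair: `v ∈ W^P`, `S ⊆ Ψ` a set of pairwise orthogonal roots with
`v(S) ⊆ Φ⁻`. -/
def Admissible (v : V ≃ₗ[ℝ] V) (S : Finset V) : Prop :=
  M.IsMinRep v ∧ (↑S : Set V) ⊆ M.Psi ∧ OrthSet S ∧ ∀ β ∈ S, v β ∈ M.Neg

/-- The length `L(v,S) = (ℓ(σ_{v(S)}) + |S|)/2` of an admissible pair `(v,S)`. -/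
def pairL (v : V ≃ₗ[ℝ] V) (S : Finset V) : ℚ :=
  ((M.length (sigmaOf (S.image fun x => v x)) : ℚ) + (S.card : ℚ)) / 2

end MRSD

namespace RSD

variable {V}
variable (D : RSD V)

/-- The nonnegative integer combinations of simple roots. -/
def cone : AddSubmonoid V where
  carrier := {x | ∃ c : V → ℕ, x = ∑ γ ∈ D.Δ, (c γ : ℝ) • γ}
  zero_mem' := ⟨0, by simp⟩
  add_mem' := by
    rintro _ _ ⟨c, rfl⟩ ⟨d, rfl⟩
    exact ⟨c + d, by simp [add_smul, Finset.sum_add_distrib]⟩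

lemma mem_neg {x : V} : x ∈ D.Neg ↔ -x ∈ D.Pos := Iff.rfl

lemma coeff_unique {c d : V → ℝ} (h : ∑ γ ∈ D.Δ, c γ • γ = ∑ γ ∈ D.Δ, d γ • γ) :
    ∀ γ ∈ D.Δ, c γ = d γ := by
  have hi : LinearIndepOn ℝ id (D.Δ : Set V) := D.Δ_indep
  intro γ hγ
  have := linearIndepOn_finset_iff.mp hi (fun γ => c γ - d γ)
    (by simp [sub_smul, Finset.sum_sub_distrib, h]) γ hγ
  linarith

lemma ne_zero {x : V} (hx : x ∈ D.Φ) : x ≠ 0 := fun h => D.nonzero (h ▸ hx)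

lemma sref_self (x : V) : sref V x x = -x := by
  rcases eq_or_ne x 0 with rfl | hx
  · simp
  · rw [sref_apply, mul_div_assoc, div_self (inner_self_ne_zero.mpr hx), mul_one, two_smul]
    abel

lemma sref_mul_self (x : V) : sref V x * sref V x = 1 :=
  LinearEquiv.ext fun y => reflMap_involutive V x y

lemma sref_inv (x : V) : (sref V x)⁻¹ = sref V x :=
  inv_eq_of_mul_eq_one_left (sref_mul_self x)

lemma inner_sref_sref (a x y : V) : ⟪sref V a x, sref V a y⟫ = ⟪x, y⟫ := by
  rcases eq_or_ne a 0 with rfl | ha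
  · simp [sref_apply]
  · have ha' : ⟪a, a⟫ ≠ 0 := inner_self_ne_zero.mpr ha
    simp only [sref_apply, inner_sub_left, inner_sub_right, real_inner_smul_left,
      real_inner_smul_right, real_inner_comm a y]
    rw [real_inner_comm y a]
    field_simp
    ring

lemma sref_sref (a x : V) : sref V (sref V a x) = sref V a * sref V x * sref V a := by
  ext y
  have hy : ⟪y, sref V a x⟫ = ⟪sref V a y, x⟫ := by
    rw [← inner_sref_sref a y (sref V a x)]
    congr 1
    exact reflMap_involutive V a x
  have hyy : sref V a (sref V a y) = y := reflMap_involutive V a y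
  simp only [LinearEquiv.mul_apply]
  rw [sref_apply V (sref V a x), sref_apply V x, map_sub, map_smul, inner_sref_sref, hy, hyy]

lemma neg_mem {x : V} (hx : x ∈ D.Φ) : -x ∈ D.Φ := by
  simpa [sref_self] using D.reflClosed x hx x hx

lemma pos_or_neg {x : V} (hx : x ∈ D.Φ) : x ∈ D.Pos ∨ x ∈ D.Neg :=
  (D.Δ_base x hx).imp (fun h => ⟨hx, h⟩) fun h => ⟨D.neg_mem hx, h⟩

lemma simple_mem_cone {a : V} (ha : a ∈ D.Δ) : a ∈ D.cone :=
  ⟨fun γ => if γ = a then 1 else 0, by simp [ha]⟩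

lemma simple_mem_pos {a : V} (ha : a ∈ D.Δ) : a ∈ D.Pos :=
  ⟨D.Δ_sub ha, D.simple_mem_cone ha⟩

/-- A positive root dominated by a multiple of a simple root is that simple root. -/
lemma eq_simple_of_smul_sub_mem {a x : V} (ha : a ∈ D.Δ) (hx : x ∈ D.Pos) {k : ℝ}
    (hk : k • a - x ∈ D.cone) : x = a := by
  obtain ⟨hxΦ, c, hc⟩ := hx
  obtain ⟨d, hd⟩ := hk
  have key := D.coeff_unique (c := fun γ => (c γ : ℝ) + d γ)
    (d := fun γ => if γ = a then k else 0) (by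
      simp only [add_smul, Finset.sum_add_distrib, ite_smul, zero_smul,
        Finset.sum_ite_eq', if_pos ha]
      rw [← hc, ← hd]
      abel)
  have hxa : x = (c a : ℝ) • a := by
    rw [hc]
    refine Finset.sum_eq_single_of_mem a ha fun γ hγ hne => ?_
    have h := key γ hγ
    rw [if_neg hne] at h
    have h0 : c γ = 0 := by
      have : c γ + d γ = 0 := by exact_mod_cast h
      omega
    simp [h0]
  rcases D.reduced a (D.Δ_sub ha) (c a) (hxa ▸ hxΦ) with h | h
  · rw [hxa, h, one_smul]
  · have : (0 : ℝ) ≤ c a := Nat.cast_nonneg _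
    linarith

lemma not_pos_and_neg {x : V} (hp : x ∈ D.Pos) (hn : x ∈ D.Neg) : False := by
  obtain ⟨hx, c, hc⟩ := hp
  obtain ⟨-, d, hd⟩ := hn
  have key := D.coeff_unique (c := fun γ => (c γ : ℝ) + d γ) (d := fun _ => 0) (by
    simp only [add_smul, Finset.sum_add_distrib, zero_smul, Finset.sum_const_zero]
    rw [← hc, ← hd]
    abel)
  refine D.ne_zero hx (hc.trans (Finset.sum_eq_zero fun γ hγ => ?_))
  have h0 : c γ = 0 := by
    have : c γ + d γ = 0 := by exact_mod_cast key γ hγ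
    omega
  simp [h0]

/-- A simple reflection permutes the positive roots other than its own simple root. -/
lemma eq_simple_of_sref_mem_neg {a x : V} (ha : a ∈ D.Δ) (hx : x ∈ D.Pos)
    (h : sref V a x ∈ D.Neg) : x = a := by
  refine D.eq_simple_of_smul_sub_mem ha hx (k := 2 * ⟪x, a⟫ / ⟪a, a⟫) ?_
  have := (D.mem_neg.mp h).2
  rwa [sref_apply, neg_sub] at this

lemma exists_word {w : V ≃ₗ[ℝ] V} (hw : w ∈ D.W) :
    ∃ l : List V, (∀ γ ∈ l, γ ∈ D.Δ) ∧ w = (l.map (sref V)).prod := by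
  induction hw using Subgroup.closure_induction with
  | mem x hx =>
    obtain ⟨γ, hγ, rfl⟩ := hx
    exact ⟨[γ], by simpa using hγ, by simp⟩
  | one => exact ⟨[], by simp, by simp⟩
  | mul x y _ _ hx hy =>
    obtain ⟨l, hl, rfl⟩ := hx
    obtain ⟨m, hm, rfl⟩ := hy
    refine ⟨l ++ m, fun γ hγ => ?_, by simp⟩
    exact (List.mem_append.mp hγ).elim (hl γ) (hm γ)
  | inv x _ hx =>
    obtain ⟨l, hl, rfl⟩ := hx
    refine ⟨l.reverse, fun γ hγ => hl γ (List.mem_reverse.mp hγ), ?_⟩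
    rw [List.prod_inv_reverse, List.map_map, List.map_reverse]
    congr 3

lemma exists_reduced_word {w : V ≃ₗ[ℝ] V} (hw : w ∈ D.W) :
    ∃ l : List V, l.length = D.length w ∧ (∀ γ ∈ l, γ ∈ D.Δ) ∧ w = (l.map (sref V)).prod := by
  obtain ⟨l, hl, h⟩ := D.exists_word hw
  exact Nat.sInf_mem (s := {n | ∃ l : List V, l.length = n ∧ (∀ γ ∈ l, γ ∈ D.Δ) ∧
    w = (l.map (sref V)).prod}) ⟨_, l, rfl, hl, h⟩

lemma length_le {w : V ≃ₗ[ℝ] V} {l : List V} (hl : ∀ γ ∈ l, γ ∈ D.Δ)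
    (h : w = (l.map (sref V)).prod) : D.length w ≤ l.length :=
  Nat.sInf_le ⟨l, rfl, hl, h⟩

lemma length_inv_le {w : V ≃ₗ[ℝ] V} (hw : w ∈ D.W) : D.length w⁻¹ ≤ D.length w := by
  obtain ⟨l, hlen, hl, rfl⟩ := D.exists_reduced_word hw
  rw [← hlen, ← List.length_reverse]
  refine D.length_le (fun γ hγ => hl γ (List.mem_reverse.mp hγ)) ?_
  rw [List.prod_inv_reverse, List.map_map, List.map_reverse]
  congr 3

lemma length_inv {w : V ≃ₗ[ℝ] V} (hw : w ∈ D.W) : D.length w⁻¹ = D.length w :=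
  le_antisymm (D.length_inv_le hw) (by simpa using D.length_inv_le (inv_mem hw))

lemma sref_mem_W {a : V} (ha : a ∈ D.Δ) : sref V a ∈ D.W :=
  Subgroup.subset_closure ⟨a, ha, rfl⟩

lemma map_mem {w : V ≃ₗ[ℝ] V} (hw : w ∈ D.W) {x : V} (hx : x ∈ D.Φ) : w x ∈ D.Φ := by
  obtain ⟨l, hl, rfl⟩ := D.exists_word hw
  induction l with
  | nil => simpa using hx
  | cons a l ih =>
    have hl' : ∀ γ ∈ l, γ ∈ D.Δ := fun γ hγ => hl γ (List.mem_cons_of_mem _ hγ)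
    have hlW : (l.map (sref V)).prod ∈ D.W := Subgroup.list_prod_mem _ fun g hg => by
      obtain ⟨γ, hγ, rfl⟩ := List.mem_map.mp hg
      exact D.sref_mem_W (hl' γ hγ)
    rw [List.map_cons, List.prod_cons, LinearEquiv.mul_apply]
    exact D.reflClosed a (D.Δ_sub (hl a List.mem_cons_self)) _ (ih hl' hlW)

/-- The strong exchange property for words in the simple reflections. -/
lemma exchange {l : List V} (hl : ∀ γ ∈ l, γ ∈ D.Δ) {x : V} (hx : x ∈ D.Pos)
    (h : (l.map (sref V)).prod⁻¹ x ∈ D.Neg) :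
    ∃ m : List V, (∀ γ ∈ m, γ ∈ D.Δ) ∧ m.length < l.length ∧
      sref V x * (l.map (sref V)).prod = (m.map (sref V)).prod := by
  induction l generalizing x with
  | nil => exact (D.not_pos_and_neg hx (by simpa using h)).elim
  | cons a l ih =>
    have ha : a ∈ D.Δ := hl a List.mem_cons_self
    have hl' : ∀ γ ∈ l, γ ∈ D.Δ := fun γ hγ => hl γ (List.mem_cons_of_mem _ hγ)
    rw [List.map_cons, List.prod_cons] at h ⊢
    rcases D.pos_or_neg (D.reflClosed a (D.Δ_sub ha) x hx.1) with hp | hn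
    · rw [mul_inv_rev, sref_inv, LinearEquiv.mul_apply] at h
      obtain ⟨m, hm, hlen, hprod⟩ := ih hl' hp h
      refine ⟨a :: m, ?_, by simpa using hlen, ?_⟩
      · intro γ hγ
        rcases List.mem_cons.mp hγ with rfl | hγ
        · exact ha
        · exact hm γ hγ
      · rw [List.map_cons, List.prod_cons, ← hprod, sref_sref]
        simp only [← mul_assoc, sref_mul_self, one_mul]
    · refine ⟨l, hl', by simp, ?_⟩
      rw [D.eq_simple_of_sref_mem_neg ha hx hn, ← mul_assoc, sref_mul_self, one_mul]

lemma length_sref_mul_lt {w : V ≃ₗ[ℝ] V} (hw : w ∈ D.W) {a : V} (ha : a ∈ D.Pos)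
    (h : w⁻¹ a ∈ D.Neg) : D.length (sref V a * w) < D.length w := by
  obtain ⟨l, hlen, hl, rfl⟩ := D.exists_reduced_word hw
  obtain ⟨m, hm, hlt, hprod⟩ := D.exchange hl ha h
  rw [← hlen]
  exact (D.length_le hm hprod).trans_lt hlt

lemma inv_apply_mem_neg {w : V ≃ₗ[ℝ] V} (hw : w ∈ D.W) {a : V} (ha : a ∈ D.Δ)
    (h : D.length (sref V a * w) < D.length w) : w⁻¹ a ∈ D.Neg := by
  refine (D.pos_or_neg (D.map_mem (inv_mem hw) (D.Δ_sub ha))).resolve_left fun hp => ?_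
  have hneg : (sref V a * w)⁻¹ a ∈ D.Neg := by
    rw [mul_inv_rev, sref_inv, LinearEquiv.mul_apply, sref_self, map_neg, mem_neg, neg_neg]
    exact hp
  have := D.length_sref_mul_lt (mul_mem (D.sref_mem_W ha) hw) (D.simple_mem_pos ha) hneg
  rw [← mul_assoc, sref_mul_self, one_mul] at this
  omega

lemma length_lt_of_blt {u w : V ≃ₗ[ℝ] V} (h : D.blt u w) : D.length u < D.length w := by
  obtain ⟨hle, hne⟩ := h
  have : u = w ∨ D.length u < D.length w := by
    induction hle using Relation.ReflTransGen.head_induction_on with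
    | refl => exact Or.inl rfl
    | head hstep _ ih =>
      rename_i x y _
      right
      rcases eq_or_ne y w with rfl | hyw
      · exact hstep.2
      · exact hstep.2.trans ((ih hyw).resolve_left hyw)
  exact this.resolve_left hne

end RSD

namespace MRSD

variable {V}

lemma IsMinRep.map_simple_mem_pos {M : MRSD V} {v : V ≃ₗ[ℝ] V} (hv : M.IsMinRep v) {γ : V}
    (hγ : γ ∈ M.Δ) (hne : γ ≠ M.αP) : v γ ∈ M.Pos := by
  refine (M.pos_or_neg (M.map_mem hv.1 (M.Δ_sub hγ))).resolve_right fun hn => ?_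
  have hs := M.sref_mem_W hγ
  have hlt := M.length_sref_mul_lt (inv_mem hv.1) (M.simple_mem_pos hγ) (by simpa using hn)
  have hle := hv.2 (v * sref V γ) (mul_mem hv.1 hs) (by
    rw [inv_mul_cancel_left]
    exact Subgroup.subset_closure ⟨γ, by simp [hne, hγ], rfl⟩)
  have hinv : sref V γ * v⁻¹ = (v * sref V γ)⁻¹ := by rw [mul_inv_rev, RSD.sref_inv]
  rw [hinv, M.length_inv (mul_mem hv.1 hs), M.length_inv hv.1] at hlt
  omega

lemma IsMinRep.map_sum_mem_cone {M : MRSD V} {v : V ≃ₗ[ℝ] V} (hv : M.IsMinRep v) {c : V → ℕ}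
    (hc : c M.αP = 0) : v (∑ γ ∈ M.Δ, (c γ : ℝ) • γ) ∈ M.cone := by
  rw [map_sum]
  refine sum_mem fun γ hγ => ?_
  rw [map_smul, Nat.cast_smul_eq_nsmul]
  rcases eq_or_ne γ M.αP with rfl | hne
  · simp [hc]
  · exact nsmul_mem (hv.map_simple_mem_pos hγ hne).2 _

lemma IsMinRep.invSet_subset_Psi {M : MRSD V} {v : V ≃ₗ[ℝ] V} (hv : M.IsMinRep v) :
    M.InvSet v ⊆ M.Psi := by
  rintro x ⟨⟨hx, c, hc⟩, hn⟩
  refine ⟨hx, c, hc, ?_⟩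
  have hne : c M.αP ≠ 0 := fun h0 =>
    M.not_pos_and_neg ⟨M.map_mem hv.1 hx, by rw [hc]; exact hv.map_sum_mem_cone h0⟩ hn
  obtain ⟨t, ht, ht1⟩ := M.θ_coeff
  obtain ⟨e, he⟩ := M.θ_high x hx
  have key := M.coeff_unique (c := fun γ => (c γ : ℝ) + e γ) (d := fun γ => (t γ : ℝ)) (by
    simp only [add_smul, Finset.sum_add_distrib]
    rw [← hc, ← he, ← ht]
    abel) M.αP M.αP_mem
  have : c M.αP + e M.αP = t M.αP := by exact_mod_cast key
  omega

lemma IsMinRep.map_sub_mem_cone {M : MRSD V} {v : V ≃ₗ[ℝ] V} (hv : M.IsMinRep v) {x y : V}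
    (hx : x ∈ M.Psi) (hy : y ∈ M.Psi) (h : M.dom x y) : v y - v x ∈ M.cone := by
  obtain ⟨-, c, hc, hc1⟩ := hx
  obtain ⟨-, d, hd, hd1⟩ := hy
  obtain ⟨e, he⟩ := h
  have key := M.coeff_unique (c := fun γ => (c γ : ℝ) + e γ) (d := fun γ => (d γ : ℝ)) (by
    simp only [add_smul, Finset.sum_add_distrib]
    rw [← hc, ← he, ← hd]
    abel) M.αP M.αP_mem
  have h0 : e M.αP = 0 := by
    have : c M.αP + e M.αP = d M.αP := by exact_mod_cast key
    omega
  rw [← map_sub, he]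
  exact hv.map_sum_mem_cone h0

end MRSD

/-- Let `v ∈ W^P`, `α ∈ Δ` with `s_α v < v`, and `β = -v⁻¹(α)`.  Then `β`
is maximal in `Φ⁺(v)` and minimal in `Ψ ∖ Φ⁺(s_α v)` for the dominance order. -/
theorem statement4 {V : Type} [NormedAddCommGroup V] [InnerProductSpace ℝ V]
    [FiniteDimensional ℝ V]
    (M : MRSD V) (v : V ≃ₗ[ℝ] V) (α : V)
    (hv : M.IsMinRep v) (hα : α ∈ M.Δ) (hlt : M.blt (sref V α * v) v) :
    (-(v⁻¹ α) ∈ M.InvSet v ∧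
      ∀ γ ∈ M.InvSet v, M.dom (-(v⁻¹ α)) γ → γ = -(v⁻¹ α)) ∧
    (-(v⁻¹ α) ∈ M.Psi \ M.InvSet (sref V α * v) ∧
      ∀ γ ∈ M.Psi \ M.InvSet (sref V α * v), M.dom γ (-(v⁻¹ α)) → γ = -(v⁻¹ α)) := by
  have hβneg : v⁻¹ α ∈ M.Neg := M.inv_apply_mem_neg hv.1 hα (M.length_lt_of_blt hlt)
  have hvβ : v (-(v⁻¹ α)) = -α := by
    rw [map_neg, ← LinearEquiv.mul_apply, mul_inv_cancel]
    rfl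
  have eq_of_map : ∀ γ, -(v γ) = α → γ = -(v⁻¹ α) := fun γ h =>
    v.injective (by rw [hvβ, ← h, neg_neg])
  have hαpos : α ∈ M.Pos := M.simple_mem_pos hα
  have hβinv : -(v⁻¹ α) ∈ M.InvSet v :=
    ⟨hβneg, by rw [hvβ, RSD.mem_neg, neg_neg]; exact hαpos⟩
  have hβΨ := hv.invSet_subset_Psi hβinv
  refine ⟨⟨hβinv, fun γ hγ hdom => ?_⟩, ⟨hβΨ, fun h => ?_⟩, fun γ hγ hdom => ?_⟩
  · refine eq_of_map γ (M.eq_simple_of_smul_sub_mem hα hγ.2 (k := 1) ?_)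
    have h := hv.map_sub_mem_cone hβΨ (hv.invSet_subset_Psi hγ) hdom
    rw [hvβ] at h
    rwa [one_smul, sub_neg_eq_add, add_comm, ← sub_neg_eq_add]
  · have h2 := h.2
    rw [LinearEquiv.mul_apply, hvβ, map_neg, RSD.sref_self, neg_neg] at h2
    exact M.not_pos_and_neg hαpos h2
  · obtain ⟨hγΨ, hγn⟩ := hγ
    have h := hv.map_sub_mem_cone hγΨ hβΨ hdom
    rw [hvβ] at h
    have hvγ : v γ ∈ M.Φ := M.map_mem hv.1 hγΨ.1
    have hneg : -(v γ) ∈ M.Pos := by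
      refine ⟨M.neg_mem hvγ, ?_⟩
      have := add_mem h (M.simple_mem_cone hα)
      rwa [show -α - v γ + α = -(v γ) by abel] at this
    refine eq_of_map γ (M.eq_simple_of_sref_mem_neg hα hneg ?_)
    obtain ⟨hγΦ, c, hc, -⟩ := hγΨ
    have hnn : sref V α (v γ) ∉ M.Neg := fun hn => hγn ⟨⟨hγΦ, c, hc⟩, hn⟩
    have hp := (M.pos_or_neg (M.reflClosed α (M.Δ_sub hα) _ hvγ)).resolve_right hnn
    rw [map_neg, RSD.mem_neg, neg_neg]
    exact hp
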